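/- Let p > 1. There exist constants C > 0 and ε ∈ (0, π_p/2) such that for all φ ∈ (π_p/2 − ε, π_p/2), |cos_p(φ)^{p−1}·sin_p(φ) − (p−1)·(π_p/2 − φ)| ≤ C·(π_p/2 − φ)^{1 + p/(p−1)}. -/

import Mathlib

open Real MeasureTheory Set

/-- `arcsin_p(x) = ∫₀ˣ (1 - s^p)^(-1/p) ds`. -/
noncomputable def arcsinP (p x : ℝ) : ℝ := ∫ s in (0:ℝ)..x, (1 - s ^ p) ^ (-1 / p)

/-- `π_p = 2 arcsin_p(1)`. -/
noncomputable def piP (p : ℝ) : ℝ := 2 * arcsinP p 1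

/-- The integrand defining `arcsinP` is integrable up to its singularity at `1`. -/
lemma intervalIntegrable_arcsinP_integrand {p : ℝ} (hp : 1 < p) :
    IntervalIntegrable (fun s : ℝ => (1 - s ^ p) ^ (-1 / p)) volume 0 1 := by
  have hp0 : 0 < p := by linarith
  have hexp : -1 < -1 / p := by
    rw [lt_div_iff₀ hp0]; linarith
  have h1 : IntervalIntegrable (fun s : ℝ => (1 - s) ^ (-1 / p)) volume 0 1 := by
    have h := (intervalIntegral.intervalIntegrable_rpow' (a := 1) (b := 0) hexp).comp_sub_left 1
    simpa using h
  refine h1.mono_fun' ?_ ?_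
  · exact Measurable.aestronglyMeasurable (by fun_prop)
  · have hne : ∀ᵐ s : ℝ ∂(volume.restrict (uIoc (0:ℝ) 1)), s ≠ 1 :=
      ae_restrict_of_ae (Measure.ae_ne volume 1)
    filter_upwards [hne, ae_restrict_mem measurableSet_uIoc] with s hs1 hs
    rw [uIoc_of_le zero_le_one] at hs
    have hlt : s < 1 := lt_of_le_of_ne hs.2 hs1
    have hsp : s ^ p ≤ s := by
      simpa using rpow_le_rpow_of_exponent_ge hs.1 hs.2 hp.le
    rw [norm_of_nonneg (rpow_nonneg (by linarith) _)]
    exact rpow_le_rpow_of_nonpos (by linarith) (by linarith)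
      (div_nonpos_of_nonpos_of_nonneg (by norm_num) hp0.le)

lemma one_sub_rpow_pos {p x : ℝ} (hp : 1 < p) (hx : x ∈ Ioo (0:ℝ) 1) : 0 < 1 - x ^ p := by
  have := rpow_lt_one hx.1.le hx.2 (by linarith : 0 < p)
  linarith

lemma hasDerivAt_arcsinP {p x : ℝ} (hp : 1 < p) (hx : x ∈ Ioo (0:ℝ) 1) :
    HasDerivAt (arcsinP p) ((1 - x ^ p) ^ (-1 / p)) x := by
  refine intervalIntegral.integral_hasDerivAt_right
    ((intervalIntegrable_arcsinP_integrand hp).mono_set ?_) ?_ ?_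
  · rw [uIcc_of_le hx.1.le, uIcc_of_le zero_le_one]
    exact Icc_subset_Icc_right hx.2.le
  · exact (Measurable.stronglyMeasurable (by fun_prop)).stronglyMeasurableAtFilter
  · exact ((continuousAt_const.sub (continuousAt_id.rpow_const (Or.inl hx.1.ne'))).rpow_const
      (Or.inl (one_sub_rpow_pos hp hx).ne'))

lemma continuousOn_arcsinP {p : ℝ} (hp : 1 < p) : ContinuousOn (arcsinP p) (Icc 0 1) := by
  have h := (intervalIntegrable_arcsinP_integrand hp)
  rw [intervalIntegrable_iff_integrableOn_Icc_of_le zero_le_one] at h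
  have := intervalIntegral.continuousOn_primitive_interval (a := (0:ℝ)) (b := 1)
    (μ := volume) (f := fun s : ℝ => (1 - s ^ p) ^ (-1 / p))
    (by rwa [uIcc_of_le zero_le_one])
  rwa [uIcc_of_le zero_le_one] at this

lemma continuous_one_sub_rpow_rpow {p : ℝ} (hp : 1 < p) :
    Continuous fun x : ℝ => (1 - x ^ p) ^ (1 - 1 / p) := by
  have hp0 : 0 < p := by linarith
  have : 0 ≤ 1 - 1 / p := by
    rw [sub_nonneg, div_le_one hp0]; exact hp.le
  exact (continuous_const.sub (continuous_id.rpow_const fun _ => Or.inr hp0.le)).rpow_const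
    fun _ => Or.inr this

/-- The derivative of `cos_p ^ (p - 1)` in terms of the value `x` of `sin_p`. -/
lemma hasDerivAt_one_sub_rpow_rpow {p x : ℝ} (hp : 1 < p) (hx : x ∈ Ioo (0:ℝ) 1) :
    HasDerivAt (fun x : ℝ => (1 - x ^ p) ^ (1 - 1 / p))
      (-(p - 1) * x ^ (p - 1) * (1 - x ^ p) ^ (-1 / p)) x := by
  have hp0 : p ≠ 0 := by linarith
  have h1 := (hasDerivAt_rpow_const (x := x) (p := p) (Or.inl hx.1.ne')).const_sub 1
  have h2 := h1.rpow_const (p := 1 - 1 / p) (Or.inl (one_sub_rpow_pos hp hx).ne')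
  refine h2.congr_deriv ?_
  rw [show (1 - 1 / p - 1 : ℝ) = -1 / p by ring]
  field_simp

/-- `cos_p ^ (p - 1)` is at most `p - 1` times the distance of the angle to `π_p / 2`. -/
lemma one_sub_rpow_rpow_le {p x : ℝ} (hp : 1 < p) (hx0 : 0 ≤ x) (hx1 : x < 1) :
    (1 - x ^ p) ^ (1 - 1 / p) ≤ (p - 1) * (arcsinP p 1 - arcsinP p x) := by
  have hsub : Icc x 1 ⊆ Icc (0:ℝ) 1 := Icc_subset_Icc_left hx0
  obtain ⟨c, hc, hceq⟩ := exists_hasDerivAt_eq_slope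
    (fun y => (p - 1) * arcsinP p y + (1 - y ^ p) ^ (1 - 1 / p))
    (fun y => (p - 1) * (1 - y ^ p) ^ (-1 / p)
      + -(p - 1) * y ^ (p - 1) * (1 - y ^ p) ^ (-1 / p)) hx1
    ((((continuousOn_arcsinP hp).mono hsub).const_mul _).add
      (continuous_one_sub_rpow_rpow hp).continuousOn)
    (fun y hy => ((hasDerivAt_arcsinP hp ⟨hx0.trans_lt hy.1, hy.2⟩).const_mul _).add
      (hasDerivAt_one_sub_rpow_rpow hp ⟨hx0.trans_lt hy.1, hy.2⟩))
  have hc' : c ∈ Ioo (0:ℝ) 1 := ⟨hx0.trans_lt hc.1, hc.2⟩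
  have hcle : c ^ (p - 1) ≤ 1 := rpow_le_one hc'.1.le hc'.2.le (by linarith)
  have hpos : 0 ≤ (1 - c ^ p) ^ (-1 / p) := rpow_nonneg (one_sub_rpow_pos hp hc').le _
  have hslope : 0 ≤ (p - 1) * (1 - c ^ p) ^ (-1 / p)
      + -(p - 1) * c ^ (p - 1) * (1 - c ^ p) ^ (-1 / p) := by
    have : 0 ≤ (p - 1) * ((1 - c ^ p) ^ (-1 / p)) * (1 - c ^ (p - 1)) :=
      mul_nonneg (mul_nonneg (by linarith) hpos) (by linarith)
    linarith
  rw [eq_div_iff (by linarith)] at hceq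
  have hprod := mul_nonneg hslope (by linarith : 0 ≤ 1 - x)
  have hexp : 1 - 1 / p ≠ 0 := by
    have : 1 / p < 1 := by rw [div_lt_one (by linarith)]; exact hp
    linarith
  rw [hceq] at hprod
  simp only [one_rpow, sub_self, zero_rpow hexp] at hprod
  linarith

/-- The error in approximating `cos_p ^ (p - 1) * sin_p` is controlled by `cos_p ^ (p - 1)`. -/
lemma abs_one_sub_rpow_rpow_mul_sub_le {p x : ℝ} (hp : 1 < p) (hx0 : 0 ≤ x) (hx1 : x < 1) :
    |(1 - x ^ p) ^ (1 - 1 / p) * x - (p - 1) * (arcsinP p 1 - arcsinP p x)| ≤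
      p * (1 - x ^ p) ^ (1 - 1 / p) * (1 - x) := by
  have hsub : Icc x 1 ⊆ Icc (0:ℝ) 1 := Icc_subset_Icc_left hx0
  obtain ⟨c, hc, hceq⟩ := exists_hasDerivAt_eq_slope
    (fun y => (p - 1) * arcsinP p y + (1 - y ^ p) ^ (1 - 1 / p) * y)
    (fun y => p * (1 - y ^ p) ^ (1 - 1 / p)) hx1
    ((((continuousOn_arcsinP hp).mono hsub).const_mul _).add
      ((continuous_one_sub_rpow_rpow hp).mul continuous_id).continuousOn)
    (fun y hy => by
      have hy' : y ∈ Ioo (0:ℝ) 1 := ⟨hx0.trans_lt hy.1, hy.2⟩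
      refine (((hasDerivAt_arcsinP hp hy').const_mul (p - 1)).add
        ((hasDerivAt_one_sub_rpow_rpow hp hy').mul (hasDerivAt_id y))).congr_deriv ?_
      have hW : (1 - y ^ p) ^ (1 - 1 / p) = (1 - y ^ p) * (1 - y ^ p) ^ (-1 / p) := by
        rw [show 1 - 1 / p = 1 + -1 / p by ring, rpow_add (one_sub_rpow_pos hp hy'), rpow_one]
      have hyp : y ^ p = y ^ (p - 1) * y := by
        rw [← rpow_add_one hy'.1.ne', sub_add_cancel]
      simp only [id, hW]
      linear_combination (p - 1) * (1 - y ^ p) ^ (-1 / p) * hyp)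
  have hc' : c ∈ Ioo (0:ℝ) 1 := ⟨hx0.trans_lt hc.1, hc.2⟩
  have hexp : 0 < 1 - 1 / p := by
    have : 1 / p < 1 := by rw [div_lt_one (by linarith)]; exact hp
    linarith
  rw [eq_div_iff (by linarith)] at hceq
  simp only [one_rpow, sub_self, zero_rpow hexp.ne'] at hceq
  have hWc : (1 - c ^ p) ^ (1 - 1 / p) ≤ (1 - x ^ p) ^ (1 - 1 / p) := by
    refine rpow_le_rpow (one_sub_rpow_pos hp hc').le ?_ hexp.le
    have := rpow_le_rpow hx0 hc.1.le (by linarith : 0 ≤ p)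
    linarith
  have hnonneg : 0 ≤ p * (1 - c ^ p) ^ (1 - 1 / p) * (1 - x) :=
    mul_nonneg (mul_nonneg (by linarith) (rpow_nonneg (one_sub_rpow_pos hp hc').le _))
      (by linarith)
  have heq : (1 - x ^ p) ^ (1 - 1 / p) * x - (p - 1) * (arcsinP p 1 - arcsinP p x)
      = -(p * (1 - c ^ p) ^ (1 - 1 / p) * (1 - x)) := by linarith
  rw [heq, abs_neg, abs_of_nonneg hnonneg]
  gcongr

/-- for `p > 1` there are `C > 0` and `ε ∈ (0, π_p/2)` such that for all
`φ ∈ (π_p/2 - ε, π_p/2)`,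
`|cos_p(φ)^(p-1) sin_p(φ) - (p-1)(π_p/2 - φ)| ≤ C (π_p/2 - φ)^(1 + p/(p-1))`. -/
theorem stmt11 (p : ℝ) (hp : 1 < p) (sinp : ℝ → ℝ)
    (hmaps : ∀ t ∈ Icc (0:ℝ) (piP p / 2), sinp t ∈ Icc (0:ℝ) 1)
    (hleft : ∀ x ∈ Icc (0:ℝ) 1, sinp (arcsinP p x) = x)
    (hright : ∀ t ∈ Icc (0:ℝ) (piP p / 2), arcsinP p (sinp t) = t) :
    ∃ C > (0:ℝ), ∃ ε : ℝ, 0 < ε ∧ ε < piP p / 2 ∧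
      ∀ φ ∈ Ioo (piP p / 2 - ε) (piP p / 2),
        |((1 - sinp φ ^ p) ^ (1 / p)) ^ (p - 1) * sinp φ - (p - 1) * (piP p / 2 - φ)| ≤
          C * (piP p / 2 - φ) ^ (1 + p / (p - 1)) := by
  have hp0 : 0 < p := by linarith
  have hp1 : 0 < p - 1 := by linarith
  have hpi : piP p / 2 = arcsinP p 1 := by unfold piP; ring
  have hpipos : 0 < arcsinP p 1 := by
    have h := one_sub_rpow_rpow_le hp le_rfl one_pos
    have h0 : arcsinP p 0 = 0 := intervalIntegral.integral_same
    rw [h0, zero_rpow hp0.ne', sub_zero, one_rpow, sub_zero] at h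
    exact pos_of_mul_pos_right (one_pos.trans_le h) hp1.le
  rw [hpi] at hmaps hright ⊢
  refine ⟨p * (p - 1) ^ (1 + p / (p - 1)), by positivity, arcsinP p 1 / 2, by linarith,
    by linarith, fun φ hφ => ?_⟩
  have hφ' : φ ∈ Icc (0:ℝ) (arcsinP p 1) := ⟨by linarith [hφ.1], hφ.2.le⟩
  have hxmem := hmaps φ hφ'
  have hφx := hright φ hφ'
  set x := sinp φ
  have hx1 : x < 1 := by
    refine lt_of_le_of_ne hxmem.2 fun h => ?_
    rw [h] at hφx
    exact hφ.2.ne hφx.symm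
  have hxp : x ^ p ≤ x := by
    simpa using rpow_le_rpow_of_exponent_ge' hxmem.1 hxmem.2 zero_le_one hp.le
  have hcos : ((1 - x ^ p) ^ (1 / p)) ^ (p - 1) = (1 - x ^ p) ^ (1 - 1 / p) := by
    rw [← rpow_mul (by linarith)]
    congr 1
    field_simp
  have hW := one_sub_rpow_rpow_le hp hxmem.1 hx1
  have hE := abs_one_sub_rpow_rpow_mul_sub_le hp hxmem.1 hx1
  rw [hφx] at hW hE
  rw [hcos]
  set W := (1 - x ^ p) ^ (1 - 1 / p) with hWdef
  have hWpos : 0 < W := rpow_pos_of_pos (by linarith) _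
  have hτ : 0 < arcsinP p 1 - φ := by linarith [hφ.2]
  have hWq : W ^ (p / (p - 1)) = 1 - x ^ p := by
    rw [hWdef, ← rpow_mul (by linarith),
      show (1 - 1 / p) * (p / (p - 1)) = 1 by field_simp, rpow_one]
  calc |W * x - (p - 1) * (arcsinP p 1 - φ)| ≤ p * W * (1 - x) := hE
    _ ≤ p * W * W ^ (p / (p - 1)) := by
        rw [hWq]; gcongr
    _ = p * W ^ (1 + p / (p - 1)) := by
        rw [rpow_add hWpos, rpow_one]; ring
    _ ≤ p * ((p - 1) * (arcsinP p 1 - φ)) ^ (1 + p / (p - 1)) := by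
        gcongr
    _ = p * (p - 1) ^ (1 + p / (p - 1)) * (arcsinP p 1 - φ) ^ (1 + p / (p - 1)) := by
        rw [mul_rpow hp1.le hτ.le]; ring
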